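/- Shell-crossing singularities do not form under the following sufficient condition: if ∂G/∂r(r,R) = 2 ∂Ψ/∂r(r,R) + 2 R Y(r,R) ∂Y/∂r(r,R) ≥ 0 for all 0 ≤ R ≤ r ≤ r₀, and √Δ(r,0) > 0 for all 0 < r ≤ r₀, then √Δ(r,R) > 0 for all 0 < r ≤ r₀ and all 0 ≤ R ≤ r. -/

import Mathlib

noncomputable section

open Real Set Filter Topology Asymptotics MeasureTheory intervalIntegral

/-- Data for an area-radius separable (ARS) spacetime: a size `r₀` of the comoving
coordinate range, generating functions `Ψ` (Misner–Sharp mass) and `Y`, the third-order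
Taylor coefficients `h30, h21, h12, h03` of `G(r,R) = 2Ψ(r,R) + R(Y(r,R)² − 1)` at the
origin, together with all the regularity and positivity requirements. -/
structure ARSData where
  r₀ : ℝ
  Ψ : ℝ → ℝ → ℝ
  Y : ℝ → ℝ → ℝ
  h30 : ℝ
  h21 : ℝ
  h12 : ℝ
  h03 : ℝ
  r₀_pos : 0 < r₀
  /-- `Ψ` and `Y` are `C^∞` on a neighborhood of `[0,r₀] × [0,r₀]`. -/
  smooth : ∃ U : Set (ℝ × ℝ), IsOpen U ∧ Icc 0 r₀ ×ˢ Icc 0 r₀ ⊆ U ∧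
      ContDiffOn ℝ (⊤ : ℕ∞) (fun p : ℝ × ℝ => Ψ p.1 p.2) U ∧
      ContDiffOn ℝ (⊤ : ℕ∞) (fun p : ℝ × ℝ => Y p.1 p.2) U
  Y_pos : ∀ r ∈ Icc (0:ℝ) r₀, ∀ R ∈ Icc (0:ℝ) r₀, 0 < Y r R
  Ψ_nonneg : ∀ r ∈ Icc (0:ℝ) r₀, ∀ R ∈ Icc (0:ℝ) r₀, 0 ≤ Ψ r R
  Ψr_nonneg : ∀ r ∈ Icc (0:ℝ) r₀, ∀ R ∈ Icc (0:ℝ) r₀, 0 ≤ deriv (fun s => Ψ s R) r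
  ΨR_nonneg : ∀ r ∈ Icc (0:ℝ) r₀, ∀ R ∈ Icc (0:ℝ) r₀, 0 ≤ deriv (fun s => Ψ r s) R
  Y_origin : Y 0 0 = 1
  Yr_origin : deriv (fun s => Y s 0) 0 = 0
  YR_origin : deriv (fun s => Y 0 s) 0 = 0
  Ψ_origin : Ψ 0 0 = 0
  Ψr_origin : deriv (fun s => Ψ s 0) 0 = 0
  ΨR_origin : deriv (fun s => Ψ 0 s) 0 = 0
  Ψrr_origin : deriv (deriv (fun s => Ψ s 0)) 0 = 0
  ΨrR_origin : deriv (fun s => deriv (fun t => Ψ s t) 0) 0 = 0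
  ΨRR_origin : deriv (deriv (fun s => Ψ 0 s)) 0 = 0
  /-- Third-order Taylor expansion of `G(r,R) = 2Ψ + R(Y²−1)` at the origin. -/
  taylor : (fun p : ℝ × ℝ =>
      (2 * Ψ p.1 p.2 + p.2 * ((Y p.1 p.2) ^ 2 - 1)) -
        (h30 * p.1 ^ 3 + h21 * p.1 ^ 2 * p.2 + h12 * p.1 * p.2 ^ 2 + h03 * p.2 ^ 3))
      =o[𝓝[Icc (0:ℝ) r₀ ×ˢ Icc (0:ℝ) r₀] (0, 0)] fun p : ℝ × ℝ => (p.1 + p.2) ^ 3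
  /-- `α = h₃₀ > 0`. -/
  α_pos : 0 < h30
  /-- `P(τ) = Σ_{i+j=3} h_{ij} τ^j > 0` on `[0,1]`. -/
  P_pos : ∀ τ ∈ Icc (0:ℝ) 1, 0 < h30 + h21 * τ + h12 * τ ^ 2 + h03 * τ ^ 3
  G_pos : ∀ r R : ℝ, 0 < R → R ≤ r → r ≤ r₀ →
      0 < 2 * Ψ r R + R * ((Y r R) ^ 2 - 1)

namespace ARSData

variable (a : ARSData)

/-- `G(r,R) := 2Ψ(r,R) + R(Y(r,R)² − 1)`. -/
def G (r R : ℝ) : ℝ := 2 * a.Ψ r R + R * ((a.Y r R) ^ 2 - 1)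

/-- `H(r,R) := √(R/G(r,R))`. -/
def H (r R : ℝ) : ℝ := Real.sqrt (R / a.G r R)

/-- `u(r,R) := √(G(r,R)/R)`. -/
def u (r R : ℝ) : ℝ := Real.sqrt (a.G r R / R)

/-- `√Δ(r,R) := ∫_R^r (1/Y(r,σ)) ∂H/∂r(r,σ) dσ + H(r,r)/Y(r,r)`. -/
def sqrtΔ (r R : ℝ) : ℝ :=
  (∫ σ in R..r, (a.Y r σ)⁻¹ * deriv (fun s => a.H s σ) r) + a.H r r / a.Y r r

/-- `P(τ) := Σ_{i+j=3} h_{ij} τ^j`. -/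
def P (τ : ℝ) : ℝ := a.h30 + a.h21 * τ + a.h12 * τ ^ 2 + a.h03 * τ ^ 3

end ARSData


/-- The derivative in the first variable of a smooth function of two variables. -/
theorem hasDerivAt_fst_of_contDiffOn {f : ℝ → ℝ → ℝ} {U : Set (ℝ × ℝ)} (hU : IsOpen U)
    (hf : ContDiffOn ℝ (⊤ : ℕ∞) (fun p : ℝ × ℝ => f p.1 p.2) U) {r σ : ℝ} (h : (r, σ) ∈ U) :
    HasDerivAt (fun s => f s σ) (fderiv ℝ (fun p : ℝ × ℝ => f p.1 p.2) (r, σ) (1, 0)) r := by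
  have hd : DifferentiableAt ℝ (fun p : ℝ × ℝ => f p.1 p.2) (r, σ) :=
    (hf.contDiffAt (hU.mem_nhds h)).differentiableAt (by simp)
  have hl : HasDerivAt (fun s : ℝ => (s, σ)) ((1 : ℝ), (0 : ℝ)) r :=
    (hasDerivAt_id r).prodMk (hasDerivAt_const r σ)
  exact hd.hasFDerivAt.comp_hasDerivAt r hl

/-- The derivative in the first variable of a smooth function is continuous along vertical
segments. -/
theorem continuousOn_deriv_fst_of_contDiffOn {f : ℝ → ℝ → ℝ} {U : Set (ℝ × ℝ)} (hU : IsOpen U)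
    (hf : ContDiffOn ℝ (⊤ : ℕ∞) (fun p : ℝ × ℝ => f p.1 p.2) U) {r : ℝ} {S : Set ℝ}
    (h : ∀ σ ∈ S, (r, σ) ∈ U) :
    ContinuousOn (fun σ => deriv (fun s => f s σ) r) S := by
  have hc : ContinuousOn (fun σ : ℝ => fderiv ℝ (fun p : ℝ × ℝ => f p.1 p.2) (r, σ)) S :=
    (hf.continuousOn_fderiv_of_isOpen hU (by simp)).comp (by fun_prop) h
  exact (hc.clm_apply continuousOn_const).congr fun σ hσ =>
    (hasDerivAt_fst_of_contDiffOn hU hf (h σ hσ)).deriv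

namespace ARSData

variable (a : ARSData)

/-- The derivative of `G` in its first variable. -/
def Gr (r R : ℝ) : ℝ :=
  2 * deriv (fun s => a.Ψ s R) r + 2 * R * a.Y r R * deriv (fun s => a.Y s R) r

theorem hasDerivAt_G {r σ : ℝ} (hr : r ∈ Icc 0 a.r₀) (hσ : σ ∈ Icc 0 a.r₀) :
    HasDerivAt (fun s => a.G s σ) (a.Gr r σ) r := by
  obtain ⟨U, hU, hsub, hΨ, hY⟩ := a.smooth
  have hmem : (r, σ) ∈ U := hsub ⟨hr, hσ⟩
  have hdΨ := (hasDerivAt_fst_of_contDiffOn hU hΨ hmem).differentiableAt.hasDerivAt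
  have hdY := (hasDerivAt_fst_of_contDiffOn hU hY hmem).differentiableAt.hasDerivAt
  refine ((hdΨ.const_mul 2).add (((hdY.pow 2).sub_const 1).const_mul σ)).congr_deriv ?_
  simp only [Gr]
  push_cast
  ring

theorem continuousOn_Y {r : ℝ} (hr : r ∈ Icc 0 a.r₀) :
    ContinuousOn (fun σ => a.Y r σ) (Icc 0 a.r₀) := by
  obtain ⟨U, -, hsub, -, hY⟩ := a.smooth
  exact hY.continuousOn.comp (f := fun σ : ℝ => (r, σ)) (by fun_prop)
    fun σ hσ => hsub ⟨hr, hσ⟩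

theorem continuousOn_G {r : ℝ} (hr : r ∈ Icc 0 a.r₀) :
    ContinuousOn (fun σ => a.G r σ) (Icc 0 a.r₀) := by
  obtain ⟨U, -, hsub, hΨ, -⟩ := a.smooth
  have hc : ContinuousOn (fun σ => a.Ψ r σ) (Icc 0 a.r₀) :=
    hΨ.continuousOn.comp (f := fun σ : ℝ => (r, σ)) (by fun_prop) fun σ hσ => hsub ⟨hr, hσ⟩
  exact (hc.const_mul 2).add (continuousOn_id.mul (((a.continuousOn_Y hr).pow 2).sub
    continuousOn_const))

theorem continuousOn_Gr {r : ℝ} (hr : r ∈ Icc 0 a.r₀) :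
    ContinuousOn (fun σ => a.Gr r σ) (Icc 0 a.r₀) := by
  obtain ⟨U, hU, hsub, hΨ, hY⟩ := a.smooth
  have hmem : ∀ σ ∈ Icc 0 a.r₀, (r, σ) ∈ U := fun σ hσ => hsub ⟨hr, hσ⟩
  have hcΨ := continuousOn_deriv_fst_of_contDiffOn hU hΨ hmem
  have hcY := continuousOn_deriv_fst_of_contDiffOn hU hY hmem
  exact (hcΨ.const_mul 2).add
    (((continuousOn_id.const_mul 2).mul (a.continuousOn_Y hr)).mul hcY)

theorem monotoneOn_G_zero : MonotoneOn (fun s => a.G s 0) (Icc 0 a.r₀) := by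
  have hz : (0 : ℝ) ∈ Icc 0 a.r₀ := ⟨le_rfl, a.r₀_pos.le⟩
  have hd := fun s (hs : s ∈ Icc 0 a.r₀) => a.hasDerivAt_G hs hz
  refine monotoneOn_of_deriv_nonneg (convex_Icc _ _)
    (fun s hs => (hd s hs).continuousAt.continuousWithinAt)
    (fun s hs => (hd s (interior_subset hs)).differentiableAt.differentiableWithinAt)
    fun s hs => ?_
  rw [(hd s (interior_subset hs)).deriv]
  simpa [Gr] using a.Ψr_nonneg s (interior_subset hs) 0 hz

/-- The cubic term in `r` dominates `G(r,0)` near the center, so `G(r,0) > 0` off the center. -/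
theorem G_zero_pos {r : ℝ} (hr : r ∈ Ioc 0 a.r₀) : 0 < a.G r 0 := by
  have hz : (0 : ℝ) ∈ Icc 0 a.r₀ := ⟨le_rfl, a.r₀_pos.le⟩
  have ht : Tendsto (fun s : ℝ => (s, (0 : ℝ))) (𝓝[Ioc 0 r] 0)
      (𝓝[Icc (0 : ℝ) a.r₀ ×ˢ Icc (0 : ℝ) a.r₀] (0, 0)) := by
    have hc : Continuous fun s : ℝ => (s, (0 : ℝ)) := by fun_prop
    refine hc.continuousWithinAt.tendsto_nhdsWithin fun s hs => ⟨⟨hs.1.le, hs.2.trans hr.2⟩, hz⟩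
  have hb := (a.taylor.comp_tendsto ht).def (half_pos a.α_pos)
  have : (𝓝[Ioc 0 r] (0 : ℝ)).NeBot := by
    rw [nhdsWithin_Ioc_eq_nhdsGT hr.1]; infer_instance
  obtain ⟨s, hs, hsr⟩ := (hb.and self_mem_nhdsWithin).exists
  have hs3 : 0 < s ^ 3 := pow_pos hsr.1 3
  have hGs : 0 < a.G s 0 := by
    simp only [Function.comp_apply, Real.norm_eq_abs, add_zero, abs_of_pos hs3] at hs
    have hlow := (abs_le.mp hs).1
    have hpos := mul_pos a.α_pos hs3
    simp only [G]
    linarith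
  exact hGs.trans_le (a.monotoneOn_G_zero ⟨hsr.1.le, hsr.2.trans hr.2⟩ ⟨hr.1.le, hr.2⟩ hsr.2)

theorem G_pos_of_mem {r σ : ℝ} (hr : r ∈ Ioc 0 a.r₀) (hσ : σ ∈ Icc 0 r) : 0 < a.G r σ := by
  rcases hσ.1.eq_or_lt with h | h
  · exact h ▸ a.G_zero_pos hr
  · exact a.G_pos r σ h hσ.2 hr.2

/-- The derivative of `H` in its first variable, in a form that is continuous up to `σ = 0`. -/
theorem deriv_H {r σ : ℝ} (hr : r ∈ Ioc 0 a.r₀) (hσ : σ ∈ Icc 0 r) :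
    deriv (fun s => a.H s σ) r = -(√σ * √(a.G r σ) * a.Gr r σ / (2 * a.G r σ ^ 2)) := by
  have hG := a.G_pos_of_mem hr hσ
  rcases hσ.1.eq_or_lt with rfl | hpos
  · simp [H]
  have hd := a.hasDerivAt_G ⟨hr.1.le, hr.2⟩ ⟨hσ.1, hσ.2.trans hr.2⟩
  have hH := (((hasDerivAt_const r σ).div hd hG.ne').sqrt (div_pos hpos hG).ne').deriv
  refine hH.trans ?_
  rw [Pi.div_apply, Real.sqrt_div hpos.le]
  have h1 : √σ ≠ 0 := (Real.sqrt_pos.mpr hpos).ne'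
  have h2 : √(a.G r σ) ≠ 0 := (Real.sqrt_pos.mpr hG).ne'
  have h3 := hG.ne'
  field_simp
  rw [Real.sq_sqrt hpos.le]
  ring

theorem deriv_H_nonpos {r σ : ℝ} (hr : r ∈ Ioc 0 a.r₀) (hσ : σ ∈ Icc 0 r) (hGr : 0 ≤ a.Gr r σ) :
    deriv (fun s => a.H s σ) r ≤ 0 := by
  rw [a.deriv_H hr hσ]
  exact neg_nonpos.mpr (by positivity)

theorem intervalIntegrable_sqrtΔ {r : ℝ} (hr : r ∈ Ioc 0 a.r₀) :
    IntervalIntegrable (fun σ => (a.Y r σ)⁻¹ * deriv (fun s => a.H s σ) r) volume 0 r := by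
  have hr' : r ∈ Icc 0 a.r₀ := ⟨hr.1.le, hr.2⟩
  have hsub : Icc 0 r ⊆ Icc 0 a.r₀ := Icc_subset_Icc_right hr.2
  refine ContinuousOn.intervalIntegrable_of_Icc hr.1.le ?_
  have hG := (a.continuousOn_G hr').mono hsub
  have hH : ContinuousOn (fun σ => deriv (fun s => a.H s σ) r) (Icc 0 r) :=
    ((((Real.continuous_sqrt.continuousOn).mul hG.sqrt).mul
      ((a.continuousOn_Gr hr').mono hsub)).div ((hG.pow 2).const_mul 2) fun σ hσ =>
        (mul_pos two_pos (pow_pos (a.G_pos_of_mem hr hσ) 2)).ne').neg.congr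
      fun σ hσ => a.deriv_H hr hσ
  exact (((a.continuousOn_Y hr').mono hsub).inv₀ fun σ hσ =>
    (a.Y_pos r hr' σ (hsub hσ)).ne').mul hH

theorem sqrtΔ_zero_le {r R : ℝ} (hr : r ∈ Ioc 0 a.r₀) (hR : R ∈ Icc 0 r)
    (hGr : ∀ σ ∈ Icc 0 r, 0 ≤ a.Gr r σ) : a.sqrtΔ r 0 ≤ a.sqrtΔ r R := by
  have hint := a.intervalIntegrable_sqrtΔ hr
  have hR' : R ∈ uIcc 0 r := by rwa [uIcc_of_le hr.1.le]
  have hsplit := integral_add_adjacent_intervals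
    (hint.mono_set (uIcc_subset_uIcc_left hR')) (hint.mono_set (uIcc_subset_uIcc_right hR'))
  have hneg : ∫ σ in (0 : ℝ)..R, (a.Y r σ)⁻¹ * deriv (fun s => a.H s σ) r ≤ 0 := by
    rw [← neg_nonneg, ← intervalIntegral.integral_neg]
    refine intervalIntegral.integral_nonneg hR.1 fun σ hσ => neg_nonneg.mpr ?_
    have hσ' : σ ∈ Icc 0 r := ⟨hσ.1, hσ.2.trans hR.2⟩
    exact mul_nonpos_of_nonneg_of_nonpos
      (inv_nonneg.mpr (a.Y_pos r ⟨hr.1.le, hr.2⟩ σ ⟨hσ'.1, hσ'.2.trans hr.2⟩).le)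
      (a.deriv_H_nonpos hr hσ' (hGr σ hσ'))
  unfold sqrtΔ
  linarith

end ARSData

/-- **Proposition (no shell-crossing singularities).** If
`∂G/∂r(r,R) = 2 ∂Ψ/∂r(r,R) + 2 R Y(r,R) ∂Y/∂r(r,R) ≥ 0` for all `0 ≤ R ≤ r ≤ r₀`,
and `√Δ(r,0) > 0` for all `0 < r ≤ r₀`, then `√Δ(r,R) > 0` for all `0 < r ≤ r₀` and
all `0 ≤ R ≤ r`: shell-crossing singularities do not form. -/
theorem no_shell_crossing (a : ARSData)
    (hGr : ∀ r ∈ Icc (0:ℝ) a.r₀, ∀ R ∈ Icc (0:ℝ) r,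
      0 ≤ 2 * deriv (fun s => a.Ψ s R) r + 2 * R * a.Y r R * deriv (fun s => a.Y s R) r)
    (h0 : ∀ r ∈ Ioc (0:ℝ) a.r₀, 0 < a.sqrtΔ r 0) :
    ∀ r ∈ Ioc (0:ℝ) a.r₀, ∀ R ∈ Icc (0:ℝ) r, 0 < a.sqrtΔ r R := by
  intro r hr R hR
  exact (h0 r hr).trans_le (a.sqrtΔ_zero_le hr hR (hGr r ⟨hr.1.le, hr.2⟩))
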